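/- Let q = q_{ℵ₀}. Then both points (q+q²)/(q⁴−1) and (1+q³)/(q⁴−1) have exactly countably infinitely many q-expansions, i.e., Σ_q((q+q²)/(q⁴−1)) and Σ_q((1+q³)/(q⁴−1)) have cardinality ℵ₀; in particular q_{ℵ₀} ∈ B_{ℵ₀}. -/

import Mathlib

noncomputable section

open Set

/-- The map `T_{q,i}(x) = q*x - i` for a binary digit `i`. -/
def Tmap (q : ℝ) (i : Fin 2) (x : ℝ) : ℝ := q * x - ((i : ℕ) : ℝ)

/-- The value `((ε_i)_{i=1}^∞)_q = ∑_{i=1}^∞ ε_i q^{-i}` of a binary sequence in base `q`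
(the sequence is 0-indexed, so digit `ε i` has weight `q^{-(i+1)}`). -/
def seqVal (q : ℝ) (ε : ℕ → Fin 2) : ℝ := ∑' i : ℕ, ((ε i : ℕ) : ℝ) / q ^ (i + 1)

/-- `Σ_q(x)`: the set of `q`-expansions of `x`. -/
def SigmaSet (q x : ℝ) : Set (ℕ → Fin 2) := {ε | x = seqVal q ε}

/-- The interval `I_q = [0, 1/(q-1)]`. -/
def Iq (q : ℝ) : Set ℝ := Icc 0 (1 / (q - 1))

/-- The switch region `S_q = [1/q, 1/(q(q-1))]`. -/
def Sq (q : ℝ) : Set ℝ := Icc (1 / q) (1 / (q * (q - 1)))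

/-- The interval `J_q = [(q+q²)/(q⁴-1), (1+q³)/(q⁴-1)]`. -/
def Jq (q : ℝ) : Set ℝ := Icc ((q + q ^ 2) / (q ^ 4 - 1)) ((1 + q ^ 3) / (q ^ 4 - 1))

/-- Apply the first `n` maps of a sequence of maps to `x`:
`applySeq a n x = (a_{n-1} ∘ ⋯ ∘ a_0)(x)`. -/
def applySeq (a : ℕ → ℝ → ℝ) (n : ℕ) (x : ℝ) : ℝ := (List.range n).foldl (fun y k => a k y) x

/-- `Ω_q(x)`: the set of sequences of maps, each equal to `T_{q,0}` or `T_{q,1}`,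
all of whose partial compositions applied to `x` stay in `I_q`. -/
def OmegaSet (q x : ℝ) : Set (ℕ → ℝ → ℝ) :=
  {a | (∀ n, a n = Tmap q 0 ∨ a n = Tmap q 1) ∧ ∀ n : ℕ, applySeq a (n + 1) x ∈ Iq q}

/-- Apply a finite word of digits to `x` (first letter applied first):
for `a = [a₁, …, aₙ]`, `wordMap q a x = (T_{q,aₙ} ∘ ⋯ ∘ T_{q,a₁})(x)`. -/
def wordMap (q : ℝ) (a : List (Fin 2)) (x : ℝ) : ℝ := a.foldl (fun y i => Tmap q i y) x

/-- A branching sequence for `x`: a finite word whose partial compositions applied to `x`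
stay in `I_q`, and whose full composition maps `x` into the switch region `S_q`. -/
def IsBranching (q x : ℝ) (a : List (Fin 2)) : Prop :=
  (∀ k, k ≤ a.length → wordMap q (a.take k) x ∈ Iq q) ∧ wordMap q a x ∈ Sq q

/-- `x` is a `q` null infinite point: `x ∈ (0,1/(q-1))`, `Ω_q(x)` is infinite, and for every
branching sequence `a` for `x` there is a digit `i` with `Ω_q(T_{q,i}(a(x)))` finite. -/
def NullInfinite (q x : ℝ) : Prop :=
  x ∈ Ioo 0 (1 / (q - 1)) ∧ (OmegaSet q x).Infinite ∧
    ∀ a : List (Fin 2), IsBranching q x a →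
      ∃ i : Fin 2, (OmegaSet q (Tmap q i (wordMap q a x))).Finite

/-- `U_q`: points of `I_q` with exactly one `q`-expansion. -/
def UniqSet (q : ℝ) : Set ℝ := {x | x ∈ Iq q ∧ ∃! ε : ℕ → Fin 2, ε ∈ SigmaSet q x}

/-- `B_{ℵ₀}`: bases `q ∈ (1,2)` for which some `x ∈ (0,1/(q-1))` has exactly countably
infinitely many `q`-expansions. -/
def BAleph0 : Set ℝ :=
  {q | q ∈ Ioo (1 : ℝ) 2 ∧ ∃ x ∈ Ioo (0 : ℝ) (1 / (q - 1)),
    Cardinal.mk ↥(SigmaSet q x) = Cardinal.aleph0}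

/-- The eventually periodic binary sequence `u w^∞`: the finite word `u` followed by
infinitely many repetitions of the finite word `w`. -/
def uwInf (u w : List (Fin 2)) : ℕ → Fin 2 := fun i =>
  if i < u.length then u.getD i 0 else w.getD ((i - u.length) % w.length) 0

theorem summable_digits {q : ℝ} (hq : 1 < q) (ε : ℕ → Fin 2) :
    Summable fun i : ℕ => ((ε i : ℕ) : ℝ) / q ^ (i + 1) := by
  have hg : Summable fun i : ℕ => (1 / q) ^ (i + 1) :=
    (summable_nat_add_iff 1).2
      (summable_geometric_of_lt_one (by positivity) ((div_lt_one (by linarith)).2 hq))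
  refine hg.of_nonneg_of_le (fun i => by positivity) fun i => ?_
  rw [div_pow, one_pow]
  have h1 : ((ε i : ℕ) : ℝ) ≤ 1 := by exact_mod_cast Nat.le_of_lt_succ (ε i).isLt
  gcongr

theorem tsum_one_div_pow_succ {q : ℝ} (hq : 1 < q) :
    ∑' i : ℕ, 1 / q ^ (i + 1) = 1 / (q - 1) := by
  have h0 : q ≠ 0 := by linarith
  have h1 : q - 1 ≠ 0 := by linarith
  have h : ∀ i : ℕ, 1 / q ^ (i + 1) = 1 / q * (1 / q) ^ i := fun i => by
    rw [div_pow, one_pow, pow_succ]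
    field_simp
  simp_rw [h]
  rw [tsum_mul_left,
    tsum_geometric_of_lt_one (by positivity) ((div_lt_one (by linarith)).2 hq)]
  field_simp

theorem seqVal_nonneg {q : ℝ} (hq : 1 < q) (ε : ℕ → Fin 2) : 0 ≤ seqVal q ε :=
  tsum_nonneg fun i => by positivity

theorem seqVal_rev {q : ℝ} (hq : 1 < q) (ε : ℕ → Fin 2) :
    seqVal q (fun i => (ε i).rev) = 1 / (q - 1) - seqVal q ε := by
  rw [eq_sub_iff_add_eq, seqVal, seqVal,
    ← (summable_digits hq _).tsum_add (summable_digits hq ε), ← tsum_one_div_pow_succ hq]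
  refine tsum_congr fun i => ?_
  rw [← add_div]
  have : ∀ d : Fin 2, ((d.rev : ℕ) : ℝ) + ((d : ℕ) : ℝ) = 1 := by
    intro d
    fin_cases d <;> simp
  rw [this]

theorem seqVal_le {q : ℝ} (hq : 1 < q) (ε : ℕ → Fin 2) : seqVal q ε ≤ 1 / (q - 1) := by
  have h := seqVal_nonneg hq fun i => (ε i).rev
  rw [seqVal_rev hq] at h
  linarith

theorem seqVal_eq_zero_add {q : ℝ} (hq : 1 < q) (ε : ℕ → Fin 2) :
    q * seqVal q ε = ((ε 0 : ℕ) : ℝ) + seqVal q fun i => ε (i + 1) := by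
  have h0 : q ≠ 0 := by linarith
  rw [seqVal, (summable_digits hq ε).tsum_eq_zero_add, mul_add, ← tsum_mul_left, seqVal]
  congr 1
  · rw [zero_add, pow_one]
    field_simp
  · refine tsum_congr fun i => ?_
    rw [pow_succ _ (i + 1)]
    field_simp

theorem tail_mem_SigmaSet {q x : ℝ} (hq : 1 < q) {ε : ℕ → Fin 2} :
    (fun i => ε (i + 1)) ∈ SigmaSet q (q * x - ((ε 0 : ℕ) : ℝ)) ↔ ε ∈ SigmaSet q x := by
  have h := seqVal_eq_zero_add hq ε
  simp only [SigmaSet, mem_ofPred_eq]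
  constructor
  · intro h'
    have : q * x = q * seqVal q ε := by linarith
    exact mul_left_cancel₀ (by linarith) this
  · rintro rfl
    linarith

/-- The sequence with first digit `d` followed by `ε`. -/
def consSeq (d : Fin 2) (ε : ℕ → Fin 2) : ℕ → Fin 2
  | 0 => d
  | n + 1 => ε n

theorem consSeq_injective (d : Fin 2) : Function.Injective (consSeq d) :=
  fun _ _ h => funext fun n => congrFun h (n + 1)

theorem consSeq_mem_SigmaSet {q x : ℝ} (hq : 1 < q) {d : Fin 2} {ε : ℕ → Fin 2} :
    consSeq d ε ∈ SigmaSet q x ↔ ε ∈ SigmaSet q (q * x - ((d : ℕ) : ℝ)) :=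
  (tail_mem_SigmaSet hq).symm

theorem rev_mem_SigmaSet {q x : ℝ} (hq : 1 < q) {ε : ℕ → Fin 2} :
    (fun i => (ε i).rev) ∈ SigmaSet q (1 / (q - 1) - x) ↔ ε ∈ SigmaSet q x := by
  simp only [SigmaSet, mem_ofPred_eq, seqVal_rev hq, sub_right_inj]

theorem mk_SigmaSet_sub {q : ℝ} (hq : 1 < q) (x : ℝ) :
    Cardinal.mk (SigmaSet q (1 / (q - 1) - x)) = Cardinal.mk (SigmaSet q x) :=
  (Cardinal.mk_congr <| (Equiv.piCongrRight fun _ : ℕ => Fin.revPerm (n := 2)).subtypeEquiv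
    fun _ => (rev_mem_SigmaSet hq).symm).symm

/-- If `q * x < 1`, every expansion of `x` starts with the digit `0`. -/
theorem digit_zero_of_mul_lt_one {q x : ℝ} (hq : 1 < q) (hx : q * x < 1) {ε : ℕ → Fin 2}
    (h : ε ∈ SigmaSet q x) : ε 0 = 0 ∧ (fun i => ε (i + 1)) ∈ SigmaSet q (q * x) := by
  have ht := (tail_mem_SigmaSet hq).2 h
  have hn := seqVal_nonneg hq fun i => ε (i + 1)
  have h0 : ε 0 = 0 := by
    by_contra hne
    rw [Fin.eq_one_of_ne_zero _ hne, SigmaSet, mem_ofPred_eq] at ht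
    norm_num at ht
    linarith
  simpa [h0] using ht

/-- If `q * x < 1`, every expansion of the reflection of `x` starts with the digit `1`. -/
theorem digit_one_of_mul_lt_one {q x : ℝ} (hq : 1 < q) (hx : q * x < 1) {ε : ℕ → Fin 2}
    (h : ε ∈ SigmaSet q (1 / (q - 1) - x)) :
    ε 0 = 1 ∧ (fun i => ε (i + 1)) ∈ SigmaSet q (1 / (q - 1) - q * x) := by
  have h' := (rev_mem_SigmaSet hq).2 h
  rw [sub_sub_cancel] at h'
  obtain ⟨h0, h1⟩ := digit_zero_of_mul_lt_one hq hx h'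
  refine ⟨by rw [← Fin.rev_rev (ε 0), h0]; rfl, ?_⟩
  simpa using (rev_mem_SigmaSet hq).2 h1

theorem shift_mem_of_mem_div_pow {q c : ℝ} (hq : 1 < q) (hc0 : 0 < c) (hc : c < 1) (k : ℕ) :
    ∀ {ε : ℕ → Fin 2}, ε ∈ SigmaSet q (c / q ^ k) → (fun i => ε (i + k)) ∈ SigmaSet q c := by
  induction k with
  | zero => intro ε h; simpa using h
  | succ k ih =>
    intro ε h
    have hk : q * (c / q ^ (k + 1)) = c / q ^ k := by
      rw [pow_succ]
      field_simp
    have hlt : q * (c / q ^ (k + 1)) < 1 := by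
      rw [hk]
      exact (div_le_self hc0.le (one_le_pow₀ hq.le)).trans_lt hc
    have h' := (digit_zero_of_mul_lt_one hq hlt h).2
    rw [hk] at h'
    exact ih h'

theorem countable_shift_preimage {C : Set (ℕ → Fin 2)} (hC : C.Countable) (n : ℕ) :
    {ε : ℕ → Fin 2 | (fun i => ε (i + n)) ∈ C}.Countable := by
  have hinj : Function.Injective fun ε : ℕ → Fin 2 =>
      ((fun i : Fin n => ε i), fun i : ℕ => ε (i + n)) := by
    intro ε δ h
    simp only [Prod.mk.injEq] at h
    funext i
    rcases lt_or_ge i n with hi | hi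
    · exact congrFun h.1 ⟨i, hi⟩
    · simpa [Nat.sub_add_cancel hi] using congrFun h.2 (i - n)
  refine (((to_countable (univ : Set (Fin n → Fin 2))).prod hC).preimage hinj).mono ?_
  intro ε h
  exact ⟨mem_univ _, h⟩

theorem one_div_sub_one_sub {q : ℝ} (hq : 1 < q) :
    1 / (q - 1) - q * (1 / (q ^ 2 - 1)) = 1 / (q ^ 2 - 1) := by
  have h1 : q - 1 ≠ 0 := by linarith
  have h2 : q ^ 2 - 1 ≠ 0 := by nlinarith
  field_simp
  ring

theorem mul_one_div_sq_sub_one_lt_one {q : ℝ} (hq : 1 < q) (hg : q + 1 < q ^ 2) :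
    q * (1 / (q ^ 2 - 1)) < 1 := by
  rw [mul_one_div, div_lt_one (by linarith)]
  linarith

/-- The point `1 / (q² - 1) = ((01)^∞)_q` has at most one expansion above the golden ratio. -/
theorem subsingleton_SigmaSet_one_div_sq_sub_one {q : ℝ} (hq : 1 < q) (hg : q + 1 < q ^ 2) :
    (SigmaSet q (1 / (q ^ 2 - 1))).Subsingleton := by
  have hlt := mul_one_div_sq_sub_one_lt_one hq hg
  have hrefl := one_div_sub_one_sub hq
  suffices h : ∀ n : ℕ, ∀ ε δ : ℕ → Fin 2, ε ∈ SigmaSet q (1 / (q ^ 2 - 1)) →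
      δ ∈ SigmaSet q (1 / (q ^ 2 - 1)) → ε n = δ n from
    fun ε hε δ hδ => funext fun n => h n ε δ hε hδ
  have step : ∀ ε : ℕ → Fin 2, ε ∈ SigmaSet q (1 / (q ^ 2 - 1)) →
      ε 0 = 0 ∧ ε 1 = 1 ∧ (fun i => ε (i + 2)) ∈ SigmaSet q (1 / (q ^ 2 - 1)) := by
    intro ε hε
    obtain ⟨h0, h⟩ := digit_zero_of_mul_lt_one hq hlt hε
    rw [show q * (1 / (q ^ 2 - 1)) = 1 / (q - 1) - 1 / (q ^ 2 - 1) by linarith] at h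
    obtain ⟨h1, h⟩ := digit_one_of_mul_lt_one hq hlt h
    rw [hrefl] at h
    exact ⟨h0, h1, h⟩
  intro n
  induction n using Nat.strong_induction_on with
  | _ n ih =>
    intro ε δ hε hδ
    obtain ⟨a0, a1, a2⟩ := step ε hε
    obtain ⟨b0, b1, b2⟩ := step δ hδ
    match n with
    | 0 => rw [a0, b0]
    | 1 => rw [a1, b1]
    | m + 2 => exact ih m (by omega) _ _ a2 b2

theorem nonempty_SigmaSet_one_div_sq_sub_one {q : ℝ} (hq : 1 < q) :
    (SigmaSet q (1 / (q ^ 2 - 1))).Nonempty := by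
  have h2 : q ^ 2 - 1 ≠ 0 := by nlinarith
  let ε : ℕ → Fin 2 := fun i => if i % 2 = 0 then 0 else 1
  refine ⟨ε, ?_⟩
  have h0 := seqVal_eq_zero_add hq ε
  have h1 := seqVal_eq_zero_add hq fun i => ε (i + 1)
  have hper : (fun i => ε (i + 1 + 1)) = ε := by
    funext i
    simp [ε, add_assoc]
  rw [hper] at h1
  have e0 : ((ε 0 : ℕ) : ℝ) = 0 := by simp [ε]
  have e1 : ((ε (0 + 1) : ℕ) : ℝ) = 1 := by simp [ε]
  rw [e0] at h0
  rw [e1] at h1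
  rw [SigmaSet, mem_ofPred_eq, div_eq_iff h2]
  linear_combination (-q) * h0 - h1

section

variable {q x : ℝ}

/-- An expansion of `x` either ends in an expansion of `1 / (q² - 1)` or starts with `0110`
and continues with an expansion of `x`. -/
theorem shift_mem_or_of_mem_SigmaSet (hq : 1 < q) (hg : q + 1 < q ^ 2) (hx : x < 1)
    (hone : q * x - 1 = 1 / (q ^ 2 - 1) / q ^ 3) (hrefl : q * x = 1 / (q - 1) - x / q)
    {ε : ℕ → Fin 2} (h : ε ∈ SigmaSet q x) :
    (∃ n, (fun i => ε (i + n)) ∈ SigmaSet q (1 / (q ^ 2 - 1))) ∨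
      (fun i => ε (i + 4)) ∈ SigmaSet q x ∧ ε 0 = 0 ∧ ε 1 = 1 ∧ ε 2 = 1 ∧ ε 3 = 0 := by
  have hlt := mul_one_div_sq_sub_one_lt_one hq hg
  have hc := one_div_sub_one_sub hq
  have hc0 : 0 < 1 / (q ^ 2 - 1) := one_div_pos.2 (by linarith)
  have hc1 : 1 / (q ^ 2 - 1) < 1 := by nlinarith
  have hqx : q * (x / q) = x := by field_simp
  have hM : q * (1 / (q - 1)) - 1 = 1 / (q - 1) := by
    have : q - 1 ≠ 0 := by linarith
    field_simp
    ring
  have h1 := (tail_mem_SigmaSet hq).2 h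
  by_cases e0 : ε 0 = 0
  swap
  · rw [Fin.eq_one_of_ne_zero _ e0] at h1
    norm_num only [Fin.val_one, Nat.cast_one] at h1
    rw [hone] at h1
    exact .inl ⟨4, shift_mem_of_mem_div_pow hq hc0 hc1 3 h1⟩
  simp only [e0, Fin.val_zero, Nat.cast_zero, sub_zero] at h1
  rw [hrefl] at h1
  obtain ⟨e1, h2⟩ := digit_one_of_mul_lt_one hq (by rw [hqx]; exact hx) h1
  rw [hqx] at h2
  have h3 : (fun i => ε (i + 3)) ∈ SigmaSet q (q * (1 / (q - 1) - x) - ((ε 2 : ℕ) : ℝ)) :=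
    (tail_mem_SigmaSet hq).2 h2
  by_cases e2 : ε 2 = 0
  · left
    have h3' : (fun i => ε (i + 3)) ∈ SigmaSet q (1 / (q - 1) - 1 / (q ^ 2 - 1) / q ^ 3) := by
      have : q * (1 / (q - 1) - x) - ((0 : ℕ) : ℝ) =
          1 / (q - 1) - 1 / (q ^ 2 - 1) / q ^ 3 := by
        push_cast
        linear_combination hM - hone
      rwa [e2, Fin.val_zero, this] at h3
    have h4 := (rev_mem_SigmaSet hq).2 h3'
    rw [sub_sub_cancel] at h4
    have h6 := (rev_mem_SigmaSet hq).2 (shift_mem_of_mem_div_pow hq hc0 hc1 3 h4)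
    simp only [Fin.rev_rev] at h6
    have h7 := (digit_one_of_mul_lt_one hq hlt h6).2
    rw [hc] at h7
    exact ⟨7, h7⟩
  · right
    have h3' : (fun i => ε (i + 3)) ∈ SigmaSet q (x / q) := by
      have : q * (1 / (q - 1) - x) - ((1 : ℕ) : ℝ) = x / q := by
        push_cast
        linear_combination hM - hrefl
      rwa [Fin.eq_one_of_ne_zero _ e2, Fin.val_one, this] at h3
    obtain ⟨e3, h4⟩ := digit_zero_of_mul_lt_one hq (by rw [hqx]; exact hx) h3'
    rw [hqx] at h4
    exact ⟨h4, e0, e1, Fin.eq_one_of_ne_zero _ e2, e3⟩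

theorem countable_SigmaSet (hq : 1 < q) (hg : q + 1 < q ^ 2) (hx : x < 1)
    (hone : q * x - 1 = 1 / (q ^ 2 - 1) / q ^ 3) (hrefl : q * x = 1 / (q - 1) - x / q) :
    (SigmaSet q x).Countable := by
  let A : Set (ℕ → Fin 2) := ⋃ n : ℕ, {ε | (fun i => ε (i + n)) ∈ SigmaSet q (1 / (q ^ 2 - 1))}
  have hA : A.Countable := countable_iUnion fun n =>
    countable_shift_preimage (subsingleton_SigmaSet_one_div_sq_sub_one hq hg).countable n
  have hstep : ∀ ε ∈ SigmaSet q x \ A, (fun i => ε (i + 4)) ∈ SigmaSet q x \ A ∧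
      ε 0 = 0 ∧ ε 1 = 1 ∧ ε 2 = 1 ∧ ε 3 = 0 := by
    rintro ε ⟨hε, hεA⟩
    rcases shift_mem_or_of_mem_SigmaSet hq hg hx hone hrefl hε with h | ⟨h, hd⟩
    · exact absurd (mem_iUnion.2 h) hεA
    · refine ⟨⟨h, fun hA' => hεA ?_⟩, hd⟩
      obtain ⟨n, hn⟩ := mem_iUnion.1 hA'
      refine mem_iUnion.2 ⟨n + 4, ?_⟩
      simpa [add_assoc] using hn
  have hB : (SigmaSet q x \ A).Subsingleton := by
    suffices h : ∀ n : ℕ, ∀ ε δ : ℕ → Fin 2, ε ∈ SigmaSet q x \ A → δ ∈ SigmaSet q x \ A →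
        ε n = δ n from fun ε hε δ hδ => funext fun n => h n ε δ hε hδ
    intro n
    induction n using Nat.strong_induction_on with
    | _ n ih =>
      intro ε δ hε hδ
      obtain ⟨a, a0, a1, a2, a3⟩ := hstep ε hε
      obtain ⟨b, b0, b1, b2, b3⟩ := hstep δ hδ
      match n with
      | 0 => rw [a0, b0]
      | 1 => rw [a1, b1]
      | 2 => rw [a2, b2]
      | 3 => rw [a3, b3]
      | m + 4 => exact ih m (by omega) _ _ a b
  refine (hA.union hB.countable).mono fun ε hε => ?_
  by_cases h : ε ∈ A
  · exact .inl h
  · exact .inr ⟨hε, h⟩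

theorem infinite_SigmaSet (hq : 1 < q) (hone : q * x - 1 = 1 / (q ^ 2 - 1) / q ^ 3)
    (hrefl : q * x = 1 / (q - 1) - x / q) : (SigmaSet q x).Infinite := by
  have h0 : q ≠ 0 := by linarith
  have hM : q * (1 / (q - 1)) - 1 = 1 / (q - 1) := by
    have : q - 1 ≠ 0 := by linarith
    field_simp
    ring
  have hqx : q * (x / q) = x := by field_simp
  obtain ⟨ε, hε⟩ := nonempty_SigmaSet_one_div_sq_sub_one hq
  have hstart : consSeq 1 (consSeq 0 (consSeq 0 (consSeq 0 ε))) ∈ SigmaSet q x := by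
    simp only [consSeq_mem_SigmaSet hq]
    convert hε using 2
    norm_num
    rw [hone]
    field_simp
  have hmaps : MapsTo (fun δ => consSeq 0 (consSeq 1 (consSeq 1 (consSeq 0 δ))))
      (SigmaSet q x) (SigmaSet q x) := by
    intro δ hδ
    simp only [consSeq_mem_SigmaSet hq]
    convert hδ using 2
    norm_num
    linear_combination q * (q ^ 2 - 1) * hrefl + (1 - q ^ 2) * hqx + (q ^ 2 + q) * hM
  intro hfin
  have hinj : Function.Injective fun δ => consSeq 0 (consSeq 1 (consSeq 1 (consSeq 0 δ))) :=
    (consSeq_injective 0).comp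
      ((consSeq_injective 1).comp ((consSeq_injective 1).comp (consSeq_injective 0)))
  obtain ⟨δ, -, hδ⟩ := ((Set.Finite.injOn_iff_bijOn_of_mapsTo hfin hmaps).1 hinj.injOn).surjOn hstart
  exact absurd (congrFun hδ 0) (by simp [consSeq])

theorem mk_SigmaSet_eq_aleph0 (hq : 1 < q) (hg : q + 1 < q ^ 2) (hx : x < 1)
    (hone : q * x - 1 = 1 / (q ^ 2 - 1) / q ^ 3) (hrefl : q * x = 1 / (q - 1) - x / q) :
    Cardinal.mk (SigmaSet q x) = Cardinal.aleph0 :=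
  le_antisymm (Cardinal.le_aleph0_iff_set_countable.2 (countable_SigmaSet hq hg hx hone hrefl))
    (Cardinal.infinite_iff.1 (infinite_SigmaSet hq hone hrefl).to_subtype)

end

/-- For `q = q_{ℵ₀}`, both `(q+q²)/(q⁴−1)` and `(1+q³)/(q⁴−1)` have exactly
countably infinitely many `q`-expansions; in particular `q_{ℵ₀} ∈ B_{ℵ₀}`. -/
theorem qAleph0_points_with_countably_many_expansions
    (qA : ℝ) (hqA1 : qA ∈ Set.Ioo (1 : ℝ) 2)
    (hqA2 : qA ^ 6 = qA ^ 4 + qA ^ 3 + 2 * qA ^ 2 + qA + 1) :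
    Cardinal.mk ↥(SigmaSet qA ((qA + qA ^ 2) / (qA ^ 4 - 1))) = Cardinal.aleph0 ∧
    Cardinal.mk ↥(SigmaSet qA ((1 + qA ^ 3) / (qA ^ 4 - 1))) = Cardinal.aleph0 ∧
    qA ∈ BAleph0 := by
  obtain ⟨h1, h2⟩ := hqA1
  have hg : qA + 1 < qA ^ 2 := by
    have h : (qA ^ 2 - qA - 1) * (qA ^ 4 + qA ^ 3 + qA ^ 2 + qA) = 1 := by
      linear_combination hqA2
    have : 0 < qA ^ 2 - qA - 1 :=
      pos_of_mul_pos_left (h ▸ one_pos) (by positivity)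
    linarith
  have hn1 : qA - 1 ≠ 0 := by linarith
  have hn2 : qA ^ 2 - 1 ≠ 0 := by linarith
  have h4 : qA + qA ^ 2 < qA ^ 4 - 1 := by nlinarith
  have h4pos : 0 < qA ^ 4 - 1 := by nlinarith
  have hn4 : qA ^ 4 - 1 ≠ 0 := h4pos.ne'
  have hx : (qA + qA ^ 2) / (qA ^ 4 - 1) < 1 := (div_lt_one h4pos).2 h4
  have hone : qA * ((qA + qA ^ 2) / (qA ^ 4 - 1)) - 1 = 1 / (qA ^ 2 - 1) / qA ^ 3 := by
    field_simp
    linear_combination (-(qA - 1) * (qA ^ 2 - 1)) * hqA2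
  have hrefl : qA * ((qA + qA ^ 2) / (qA ^ 4 - 1)) =
      1 / (qA - 1) - (qA + qA ^ 2) / (qA ^ 4 - 1) / qA := by
    field_simp
    ring
  have hmain := mk_SigmaSet_eq_aleph0 h1 hg hx hone hrefl
  have hsub : (1 + qA ^ 3) / (qA ^ 4 - 1) = 1 / (qA - 1) - (qA + qA ^ 2) / (qA ^ 4 - 1) := by
    field_simp
    ring
  refine ⟨hmain, by rw [hsub, mk_SigmaSet_sub h1, hmain], ⟨h1, h2⟩, _, ⟨by positivity, ?_⟩, hmain⟩
  exact hx.trans ((one_lt_div (by linarith)).2 (by linarith))
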